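/- Let V be a physical covariance matrix of a two-mode Gaussian state whose lowest PT symplectic eigenvalue satisfies ν := ν(V) < 1 (an entangled state). Then there exists a local trace-preserving Gaussian CP map (S = S_a ⊕ S_b, G = G_a ⊕ G_b) such that the transformed matrix satisfies F(S V Sᵀ + G) ≥ (1 + ν)/(1 + 3ν). -/

import Mathlib

open Matrix
open scoped ComplexOrder

noncomputable section

/-- The 2×2 symplectic form `J = [[0,1],[-1,0]]`. -/
def J2 : Matrix (Fin 2) (Fin 2) ℝ := !![0, 1; -1, 0]

/-- `Z = diag(1,-1)`. -/
def Z2 : Matrix (Fin 2) (Fin 2) ℝ := !![1, 0; 0, -1]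

/-- The 4×4 symplectic form `Ω = diag(J, J)`. -/
def Ω4 : Matrix (Fin 2 ⊕ Fin 2) (Fin 2 ⊕ Fin 2) ℝ := fromBlocks J2 0 0 J2

/-- `V` is a physical covariance matrix of a two-mode Gaussian state: `V + iΩ` is
positive semidefinite. -/
def IsPhysCM (V : Matrix (Fin 2 ⊕ Fin 2) (Fin 2 ⊕ Fin 2) ℝ) : Prop :=
  (V.map Complex.ofReal + Complex.I • Ω4.map Complex.ofReal).PosSemidef

/-- Noise matrix `N(V) = Z A Z + Z C + Cᵀ Z + B` of a two-mode covariance matrix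
`V = [[A, C], [Cᵀ, B]]`. -/
def noiseN (V : Matrix (Fin 2 ⊕ Fin 2) (Fin 2 ⊕ Fin 2) ℝ) : Matrix (Fin 2) (Fin 2) ℝ :=
  Z2 * V.toBlocks₁₁ * Z2 + Z2 * V.toBlocks₁₂ + (V.toBlocks₁₂)ᵀ * Z2 + V.toBlocks₂₂

/-- Coherent-state teleportation fidelity `F(V) = 2 / √(det (2 I₂ + N(V)))`. -/
def fid (V : Matrix (Fin 2 ⊕ Fin 2) (Fin 2 ⊕ Fin 2) ℝ) : ℝ :=
  2 / Real.sqrt (((2 : ℝ) • (1 : Matrix (Fin 2) (Fin 2) ℝ) + noiseN V).det)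

/-- `Σ(V) = det A + det B - 2 det C`. -/
def SigmaPT (V : Matrix (Fin 2 ⊕ Fin 2) (Fin 2 ⊕ Fin 2) ℝ) : ℝ :=
  (V.toBlocks₁₁).det + (V.toBlocks₂₂).det - 2 * (V.toBlocks₁₂).det

/-- The lowest partially-transposed symplectic eigenvalue
`ν(V) = √((Σ − √(Σ² − 4 det V))/2)`. -/
def nuPT (V : Matrix (Fin 2 ⊕ Fin 2) (Fin 2 ⊕ Fin 2) ℝ) : ℝ :=
  Real.sqrt ((SigmaPT V - Real.sqrt ((SigmaPT V) ^ 2 - 4 * V.det)) / 2)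

/-- `(Sa ⊕ Sb, Ga ⊕ Gb)` is a local trace-preserving Gaussian CP map:
`Ga, Gb` symmetric and `G_k + iJ − i S_k J S_kᵀ ≥ 0` for `k = a, b`. -/
def IsLocalTGCP (Sa Sb Ga Gb : Matrix (Fin 2) (Fin 2) ℝ) : Prop :=
  Ga.IsSymm ∧ Gb.IsSymm ∧
  (Ga.map Complex.ofReal + Complex.I • J2.map Complex.ofReal -
      Complex.I • (Sa * J2 * Saᵀ).map Complex.ofReal).PosSemidef ∧
  (Gb.map Complex.ofReal + Complex.I • J2.map Complex.ofReal -
      Complex.I • (Sb * J2 * Sbᵀ).map Complex.ofReal).PosSemidef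

/-- `ΛΩΛ`: the symplectic form with the first mode time-reversed. -/
def partialTransposeForm (R : Type*) [CommRing R] : Matrix (Fin 2 ⊕ Fin 2) (Fin 2 ⊕ Fin 2) R :=
  fromBlocks !![0, -1; 1, 0] 0 0 !![0, 1; -1, 0]

theorem det_add_smul_partialTransposeForm {R : Type*} [CommRing R]
    (V : Matrix (Fin 2 ⊕ Fin 2) (Fin 2 ⊕ Fin 2) R) (hV : V.IsSymm) (μ : R) :
    (V + μ • partialTransposeForm R).det =
      V.det + μ ^ 2 * (V.toBlocks₁₁.det + V.toBlocks₂₂.det - 2 * V.toBlocks₁₂.det) + μ ^ 4 := by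
  rw [← det_reindex_self finSumFinEquiv V, ← det_reindex_self finSumFinEquiv (V + _)]
  have e : ∀ i j, V i j = V j i := fun i j => hV.apply j i
  have h0 : (finSumFinEquiv (m := 2) (n := 2)).symm 0 = Sum.inl 0 := rfl
  have h1 : (finSumFinEquiv (m := 2) (n := 2)).symm 1 = Sum.inl 1 := rfl
  have h2 : (finSumFinEquiv (m := 2) (n := 2)).symm 2 = Sum.inr 0 := rfl
  have h3 : (finSumFinEquiv (m := 2) (n := 2)).symm 3 = Sum.inr 1 := rfl
  simp [-det_submatrix_equiv_self, det_succ_row_zero, Fin.sum_univ_succ, Fin.succAbove, partialTransposeForm,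
    toBlocks₁₁, toBlocks₁₂, toBlocks₂₂, h0, h1, h2, h3, e (Sum.inl 1) (Sum.inl 0),
    e (Sum.inr 1) (Sum.inr 0), e (Sum.inr 0) (Sum.inl 0), e (Sum.inr 1) (Sum.inl 0),
    e (Sum.inr 0) (Sum.inl 1), e (Sum.inr 1) (Sum.inl 1)]
  ring

theorem posSemidef_abs_smul_one_add (d : ℝ) :
    (((|d| • (1 : Matrix (Fin 2) (Fin 2) ℝ)).map Complex.ofReal) +
      Complex.I • (d • J2).map Complex.ofReal).PosSemidef := by
  rcases le_total 0 d with h | h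
  · convert (posSemidef_vecMulVec_self_star ![(1 : ℂ), -Complex.I]).smul
      (Complex.zero_le_real.2 h) using 1
    ext i j
    rw [Matrix.smul_apply, vecMulVec_apply]
    fin_cases i <;> fin_cases j <;> simp [J2, abs_of_nonneg h, mul_comm]
  · convert (posSemidef_vecMulVec_self_star ![(1 : ℂ), Complex.I]).smul
      (Complex.zero_le_real.2 (neg_nonneg.2 h)) using 1
    ext i j
    rw [Matrix.smul_apply, vecMulVec_apply]
    fin_cases i <;> fin_cases j <;> simp [J2, abs_of_nonpos h, mul_comm]

theorem mul_J2_mul_transpose (S : Matrix (Fin 2) (Fin 2) ℝ) : S * J2 * Sᵀ = S.det • J2 := by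
  ext i j
  fin_cases i <;> fin_cases j <;>
    simp [J2, mul_apply, Fin.sum_univ_two, det_fin_two] <;> ring

/-- Isotropic noise of strength `|1 - det S|` completes any `S` to a TGCP map. -/
theorem isLocalTGCP_abs_smul_one (Sa Sb : Matrix (Fin 2) (Fin 2) ℝ) :
    IsLocalTGCP Sa Sb (|1 - Sa.det| • 1) (|1 - Sb.det| • 1) := by
  have key (S : Matrix (Fin 2) (Fin 2) ℝ) :
      ((|1 - S.det| • (1 : Matrix (Fin 2) (Fin 2) ℝ)).map Complex.ofReal +
        Complex.I • J2.map Complex.ofReal -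
        Complex.I • (S * J2 * Sᵀ).map Complex.ofReal).PosSemidef := by
    convert posSemidef_abs_smul_one_add (1 - S.det) using 1
    rw [mul_J2_mul_transpose]
    ext i j
    simp
    ring
  exact ⟨isSymm_one.smul _, isSymm_one.smul _, key Sa, key Sb⟩

/-- The noise matrix after a local map whose rows, up to time reversal, are `t x` and `t y`. -/
theorem noiseN_transform (V : Matrix (Fin 2 ⊕ Fin 2) (Fin 2 ⊕ Fin 2) ℝ) (hV : V.IsSymm)
    (x y : Fin 2 ⊕ Fin 2 → ℝ) (t ga gb : ℝ) :
    noiseN (fromBlocks (t • (Z2 * of ![x ∘ Sum.inl, y ∘ Sum.inl])) 0 0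
          (t • of ![x ∘ Sum.inr, y ∘ Sum.inr]) * V *
        (fromBlocks (t • (Z2 * of ![x ∘ Sum.inl, y ∘ Sum.inl])) 0 0
          (t • of ![x ∘ Sum.inr, y ∘ Sum.inr]))ᵀ + fromBlocks (ga • 1) 0 0 (gb • 1)) =
      t ^ 2 • !![x ⬝ᵥ V *ᵥ x, x ⬝ᵥ V *ᵥ y; y ⬝ᵥ V *ᵥ x, y ⬝ᵥ V *ᵥ y] + (ga + gb) • 1 := by
  have e : ∀ i j, V i j = V j i := fun i j => hV.apply j i
  ext i j
  simp only [noiseN, Matrix.add_apply, mul_apply, Matrix.transpose_apply, Fin.sum_univ_two,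
    Fintype.sum_sum_type, toBlocks₁₁, toBlocks₁₂, toBlocks₂₂, of_apply]
  fin_cases i <;> fin_cases j <;>
    simp [Z2, mulVec, dotProduct, Fintype.sum_sum_type, Fin.sum_univ_two,
      e (Sum.inl 1) (Sum.inl 0), e (Sum.inr 1) (Sum.inr 0), e (Sum.inr 0) (Sum.inl 0),
      e (Sum.inr 1) (Sum.inl 0), e (Sum.inr 0) (Sum.inl 1), e (Sum.inr 1) (Sum.inl 1)] <;>
    ring

theorem IsPhysCM.isSymm {V : Matrix (Fin 2 ⊕ Fin 2) (Fin 2 ⊕ Fin 2) ℝ} (hV : IsPhysCM V) :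
    V.IsSymm := by
  ext i j
  simpa using congrArg Complex.re (hV.isHermitian.apply i j)

theorem Ω4_transpose : Ω4ᵀ = -Ω4 := by
  ext i j
  rcases i with i | i <;> rcases j with j | j <;> fin_cases i <;> fin_cases j <;>
    simp [Ω4, J2]

/-- A physical covariance matrix is positive definite. -/
theorem IsPhysCM.posDef {V : Matrix (Fin 2 ⊕ Fin 2) (Fin 2 ⊕ Fin 2) ℝ} (hV : IsPhysCM V) :
    (V.map Complex.ofReal).PosDef := by
  have hT : (V.map Complex.ofReal + Complex.I • Ω4.map Complex.ofReal)ᵀ =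
      V.map Complex.ofReal - Complex.I • Ω4.map Complex.ofReal := by
    rw [transpose_add, transpose_smul, ← transpose_map, ← transpose_map, hV.isSymm.eq,
      Ω4_transpose]
    ext i j
    simp
    ring
  refine PosDef.of_dotProduct_mulVec_pos ?_ fun w hw => ?_
  · ext i j
    simpa using hV.isSymm.apply i j
  have hV' := hV.transpose
  rw [hT] at hV'
  have h1 := hV.dotProduct_mulVec_nonneg w
  have h2 := hV'.dotProduct_mulVec_nonneg w
  have hsum : star w ⬝ᵥ (V.map Complex.ofReal + Complex.I • Ω4.map Complex.ofReal) *ᵥ w +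
      star w ⬝ᵥ (V.map Complex.ofReal - Complex.I • Ω4.map Complex.ofReal) *ᵥ w =
      2 * (star w ⬝ᵥ V.map Complex.ofReal *ᵥ w) := by
    simp only [add_mulVec, sub_mulVec, dotProduct_add, dotProduct_sub]
    ring
  have h0 : 0 ≤ (2 : ℂ) * (star w ⬝ᵥ V.map Complex.ofReal *ᵥ w) := hsum ▸ add_nonneg h1 h2
  have h0' : 0 ≤ star w ⬝ᵥ V.map Complex.ofReal *ᵥ w := by
    simpa [Complex.nonneg_iff, eq_comm] using h0
  refine lt_of_le_of_ne h0' fun hz => hw ?_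
  rw [← hz, mul_zero, add_eq_zero_iff_of_nonneg h1 h2, hV.dotProduct_mulVec_zero_iff,
    hV'.dotProduct_mulVec_zero_iff, add_mulVec, sub_mulVec, smul_mulVec] at hsum
  have hk : Ω4.map Complex.ofReal *ᵥ w = 0 := by
    have h : (2 * Complex.I) • (Ω4.map Complex.ofReal *ᵥ w) = 0 := by
      rw [mul_smul, two_smul]
      linear_combination hsum.1 - hsum.2
    simpa using h
  ext i
  have k0 := congrFun hk (Sum.inl 0)
  have k1 := congrFun hk (Sum.inl 1)
  have k2 := congrFun hk (Sum.inr 0)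
  have k3 := congrFun hk (Sum.inr 1)
  simp [Ω4, J2, mulVec, dotProduct] at k0 k1 k2 k3
  rcases i with i | i <;> fin_cases i <;> simp [*]

theorem partialTransposeForm_map :
    (partialTransposeForm ℝ).map Complex.ofReal = partialTransposeForm ℂ := by
  ext i j
  rcases i with i | i <;> rcases j with j | j <;> fin_cases i <;> fin_cases j <;>
    simp [partialTransposeForm]

/-- A root `l` of `l ^ 4 - Σ l ^ 2 + det V` is real and nonzero, and is a PT symplectic
eigenvalue of `V`. -/
theorem IsPhysCM.exists_mulVec_eq_zero_of_root {V : Matrix (Fin 2 ⊕ Fin 2) (Fin 2 ⊕ Fin 2) ℝ}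
    (hV : IsPhysCM V) {l : ℂ} (hl : l ^ 4 - SigmaPT V * l ^ 2 + V.det = 0) :
    l.im = 0 ∧ l ≠ 0 ∧ ∃ w ≠ 0,
      (V.map Complex.ofReal + (Complex.I * l) • partialTransposeForm ℂ) *ᵥ w = 0 := by
  have hdet : (V.map Complex.ofReal + (Complex.I * l) • partialTransposeForm ℂ).det = 0 := by
    rw [det_add_smul_partialTransposeForm _ (by ext i j; simpa using hV.isSymm.apply i j)]
    have e1 : (V.map Complex.ofReal).det = V.det := (RingHom.map_det Complex.ofRealHom V).symm
    rw [e1, ← hl]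
    simp [SigmaPT, toBlocks₁₁, toBlocks₁₂, toBlocks₂₂, det_fin_two, mul_pow, Complex.I_pow_four]
    ring
  obtain ⟨w, hw, hw0⟩ := exists_mulVec_eq_zero_iff.2 hdet
  have hpos := hV.posDef.dotProduct_mulVec_pos hw
  have heq := congrArg (fun u => star w ⬝ᵥ u) hw0
  simp only [add_mulVec, smul_mulVec, dotProduct_add, dotProduct_smul, smul_eq_mul,
    dotProduct_zero] at heq
  have him : (Complex.I * (star w ⬝ᵥ partialTransposeForm ℂ *ᵥ w)).im = 0 := by
    simp [partialTransposeForm, mulVec, dotProduct, Fintype.sum_sum_type]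
    ring
  obtain ⟨hre, hi⟩ := Complex.pos_iff.1 hpos
  have h1 := congrArg Complex.re heq
  have h2 := congrArg Complex.im heq
  rw [mul_right_comm] at h1 h2
  generalize Complex.I * (star w ⬝ᵥ partialTransposeForm ℂ *ᵥ w) = z at *
  simp [him] at h1 h2
  have hz : z.re ≠ 0 := by rintro hz; simp [hz] at h1; linarith
  refine ⟨?_, ?_, w, hw, hw0⟩
  · have : z.re * l.im = 0 := by linarith
    simpa [hz] using this
  · rintro rfl
    simp at h1
    linarith

/-- `ν` is a positive root of `l ^ 4 - Σ l ^ 2 + det V`. -/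
theorem IsPhysCM.nuPT_root {V : Matrix (Fin 2 ⊕ Fin 2) (Fin 2 ⊕ Fin 2) ℝ} (hV : IsPhysCM V) :
    0 < nuPT V ∧ nuPT V ^ 4 - SigmaPT V * nuPT V ^ 2 + V.det = 0 := by
  have key (s : ℂ) (hs : s ^ 2 = (SigmaPT V : ℂ) ^ 2 - 4 * V.det) :
      ∃ r : ℝ, 0 < r ∧ ((SigmaPT V : ℂ) - s) / 2 = r := by
    obtain ⟨l, hl⟩ := IsAlgClosed.exists_pow_nat_eq (((SigmaPT V : ℂ) - s) / 2) two_pos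
    obtain ⟨him, h0, -⟩ := hV.exists_mulVec_eq_zero_of_root (l := l) (by
      rw [show l ^ 4 = (l ^ 2) ^ 2 by ring, hl]
      linear_combination hs / 4)
    have hlr : l = l.re := Complex.ext rfl (by simpa using him)
    refine ⟨l.re ^ 2, ?_, ?_⟩
    · have : l.re ≠ 0 := fun h => h0 (by rw [hlr, h, Complex.ofReal_zero])
      positivity
    · rw [← hl]
      nth_rewrite 1 [hlr]
      push_cast
      rfl
  have hdisc : 0 ≤ SigmaPT V ^ 2 - 4 * V.det := by
    obtain ⟨s, hs⟩ := IsAlgClosed.exists_pow_nat_eq ((SigmaPT V : ℂ) ^ 2 - 4 * V.det) two_pos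
    obtain ⟨r, -, hr⟩ := key s hs
    have hsr : s = ((SigmaPT V - 2 * r : ℝ) : ℂ) := by
      push_cast
      linear_combination -2 * hr
    rw [hsr] at hs
    have : (SigmaPT V - 2 * r) ^ 2 = SigmaPT V ^ 2 - 4 * V.det := by exact_mod_cast hs
    rw [← this]
    positivity
  have hsq := Real.sq_sqrt hdisc
  obtain ⟨r, hr0, hr⟩ := key (Real.sqrt (SigmaPT V ^ 2 - 4 * V.det)) (by exact_mod_cast hsq)
  have hr' : (SigmaPT V - Real.sqrt (SigmaPT V ^ 2 - 4 * V.det)) / 2 = r := by exact_mod_cast hr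
  have hν : nuPT V = Real.sqrt r := by rw [nuPT, hr']
  refine ⟨hν ▸ Real.sqrt_pos.2 hr0, ?_⟩
  rw [show nuPT V ^ 4 = (nuPT V ^ 2) ^ 2 by ring, hν, Real.sq_sqrt hr0.le, ← hr']
  linear_combination hsq / 4

/-- The real and imaginary parts of a PT symplectic eigenvector. -/
theorem IsPhysCM.exists_eigenvectors {V : Matrix (Fin 2 ⊕ Fin 2) (Fin 2 ⊕ Fin 2) ℝ}
    (hV : IsPhysCM V) : ∃ x y : Fin 2 ⊕ Fin 2 → ℝ,
      0 < x ⬝ᵥ partialTransposeForm ℝ *ᵥ y ∧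
      x ⬝ᵥ V *ᵥ x = nuPT V * (x ⬝ᵥ partialTransposeForm ℝ *ᵥ y) ∧
      y ⬝ᵥ V *ᵥ y = nuPT V * (x ⬝ᵥ partialTransposeForm ℝ *ᵥ y) ∧
      x ⬝ᵥ V *ᵥ y = 0 ∧ y ⬝ᵥ V *ᵥ x = 0 := by
  obtain ⟨hν, hroot⟩ := hV.nuPT_root
  obtain ⟨-, -, w, hw, hw0⟩ := hV.exists_mulVec_eq_zero_of_root (l := nuPT V) (by exact_mod_cast hroot)
  set x : Fin 2 ⊕ Fin 2 → ℝ := fun i => (w i).re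
  set y : Fin 2 ⊕ Fin 2 → ℝ := fun i => (w i).im
  have hx : V *ᵥ x = nuPT V • partialTransposeForm ℝ *ᵥ y := by
    ext i
    have := congrArg Complex.re (congrFun hw0 i)
    rw [← partialTransposeForm_map] at this
    simp [mulVec, dotProduct, add_mul, Finset.sum_add_distrib] at this ⊢
    linarith
  have hy : V *ᵥ y = -(nuPT V • partialTransposeForm ℝ *ᵥ x) := by
    ext i
    have := congrArg Complex.im (congrFun hw0 i)
    rw [← partialTransposeForm_map] at this
    simp [mulVec, dotProduct, add_mul, Finset.sum_add_distrib] at this ⊢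
    linarith
  have hskew (u v : Fin 2 ⊕ Fin 2 → ℝ) :
      u ⬝ᵥ partialTransposeForm ℝ *ᵥ v = -(v ⬝ᵥ partialTransposeForm ℝ *ᵥ u) := by
    simp [partialTransposeForm, mulVec, dotProduct, Fintype.sum_sum_type]
    ring
  have hxx := hskew x x
  have hyy := hskew y y
  have hyx := hskew y x
  have hVx : x ⬝ᵥ V *ᵥ x = nuPT V * (x ⬝ᵥ partialTransposeForm ℝ *ᵥ y) := by simp [hx]
  have hVy : y ⬝ᵥ V *ᵥ y = nuPT V * (x ⬝ᵥ partialTransposeForm ℝ *ᵥ y) := by simp [hy, hyx]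
  have hpos : 0 < x ⬝ᵥ V *ᵥ x + y ⬝ᵥ V *ᵥ y := by
    have h := (Complex.pos_iff.1 (hV.posDef.dotProduct_mulVec_pos hw)).1
    convert h using 1
    simp [mulVec, dotProduct, x, y]
    ring
  refine ⟨x, y, ?_, hVx, hVy, ?_, ?_⟩
  · rw [hVx, hVy, ← two_mul] at hpos
    exact pos_of_mul_pos_right (pos_of_mul_pos_right hpos zero_le_two) hν.le
  · rw [hy]
    simp
    right; linarith
  · rw [hx]
    simp
    right; linarith

/-- The uncertainty principle in terms of real quadratures. -/
theorem IsPhysCM.abs_symplectic_le {V : Matrix (Fin 2 ⊕ Fin 2) (Fin 2 ⊕ Fin 2) ℝ}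
    (hV : IsPhysCM V) (x y : Fin 2 ⊕ Fin 2 → ℝ) :
    2 * |x ⬝ᵥ Ω4 *ᵥ y| ≤ x ⬝ᵥ V *ᵥ x + y ⬝ᵥ V *ᵥ y := by
  have key (y : Fin 2 ⊕ Fin 2 → ℝ) : 2 * (x ⬝ᵥ Ω4 *ᵥ y) ≤ x ⬝ᵥ V *ᵥ x + y ⬝ᵥ V *ᵥ y := by
    have h := (Complex.le_def.1
      (hV.dotProduct_mulVec_nonneg fun i => (x i : ℂ) + Complex.I * y i)).1
    simp [mulVec, dotProduct, Fintype.sum_sum_type, Ω4, J2] at h ⊢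
    linarith
  have h1 := key y
  have h2 := key (-y)
  simp only [mulVec_neg, dotProduct_neg, neg_dotProduct, neg_neg] at h2
  rcases abs_cases (x ⬝ᵥ Ω4 *ᵥ y) with h | h <;> linarith [h.1]

/-- if `V` is a physical two-mode covariance matrix with
`ν(V) < 1` (entangled state), then some local TGCP map achieves fidelity at least
`(1 + ν)/(1 + 3ν)`. -/
theorem fidelity_lower_bound
    (V : Matrix (Fin 2 ⊕ Fin 2) (Fin 2 ⊕ Fin 2) ℝ) (hV : IsPhysCM V)
    (hν : nuPT V < 1) :
    ∃ Sa Sb Ga Gb : Matrix (Fin 2) (Fin 2) ℝ, IsLocalTGCP Sa Sb Ga Gb ∧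
      (1 + nuPT V) / (1 + 3 * nuPT V) ≤
        fid (fromBlocks Sa 0 0 Sb * V * (fromBlocks Sa 0 0 Sb)ᵀ + fromBlocks Ga 0 0 Gb) := by
  obtain ⟨x, y, hκ, hxx, hyy, hxy, hyx⟩ := hV.exists_eigenvectors
  have hphys := hV.abs_symplectic_le x y
  have hν0 := hV.nuPT_root.1
  set ν := nuPT V
  set κ := x ⬝ᵥ partialTransposeForm ℝ *ᵥ y with hκ_def
  set a := (Z2 * of ![x ∘ Sum.inl, y ∘ Sum.inl]).det with ha_def
  set b := (of ![x ∘ Sum.inr, y ∘ Sum.inr]).det with hb_def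
  have hκab : κ = a + b := by
    simp [hκ_def, ha_def, hb_def, partialTransposeForm, mulVec, dotProduct, det_fin_two, Z2,
      Fintype.sum_sum_type]
    ring
  have hΩab : x ⬝ᵥ Ω4 *ᵥ y = b - a := by
    simp [ha_def, hb_def, Ω4, J2, mulVec, dotProduct, det_fin_two, Z2, Fintype.sum_sum_type]
    ring
  rw [hxx, hyy, hΩab, ← two_mul] at hphys
  obtain ⟨hlo, hhi⟩ := abs_le.1 (le_of_mul_le_mul_left hphys two_pos)
  set m := max a b
  have ham : a ≤ m := le_max_left a b
  have hbm : b ≤ m := le_max_right a b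
  have hm : 0 < m := by linarith
  have hm' : 2 * m ≤ κ * (1 + ν) := by
    rcases max_cases a b with h | h <;> simp only [m, h.1] <;> linarith
  have ht : (Real.sqrt m⁻¹) ^ 2 = m⁻¹ := Real.sq_sqrt (inv_pos.2 hm).le
  refine ⟨Real.sqrt m⁻¹ • (Z2 * of ![x ∘ Sum.inl, y ∘ Sum.inl]),
    Real.sqrt m⁻¹ • of ![x ∘ Sum.inr, y ∘ Sum.inr], _, _, isLocalTGCP_abs_smul_one _ _, ?_⟩
  rw [fid, noiseN_transform V hV.isSymm, hxx, hyy, hxy, hyx, det_smul, det_smul,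
    Fintype.card_fin, ht, ← ha_def, ← hb_def, abs_of_nonneg, abs_of_nonneg]
  rotate_left
  · rw [sub_nonneg, inv_mul_le_iff₀ hm]; linarith
  · rw [sub_nonneg, inv_mul_le_iff₀ hm]; linarith
  have hn : m⁻¹ * (ν * κ) + (1 - m⁻¹ * a + (1 - m⁻¹ * b)) ≤ 4 * ν / (1 + ν) := by
    rw [le_div_iff₀ (by linarith), hκab]
    rw [hκab] at hm'
    have : m⁻¹ * m = 1 := inv_mul_cancel₀ hm.ne'
    have hq : 2 ≤ m⁻¹ * ((a + b) * (1 + ν)) := by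
      rw [← div_eq_inv_mul, le_div_iff₀ hm]; exact hm'
    nlinarith
  have hn0 : 0 ≤ m⁻¹ * (ν * κ) + (1 - m⁻¹ * a + (1 - m⁻¹ * b)) := by
    have h1 : m⁻¹ * a ≤ 1 := by rw [inv_mul_le_iff₀ hm]; linarith
    have h2 : m⁻¹ * b ≤ 1 := by rw [inv_mul_le_iff₀ hm]; linarith
    have h3 : 0 ≤ m⁻¹ * (ν * κ) := by positivity
    linarith
  set n := m⁻¹ * (ν * κ) + (1 - m⁻¹ * a + (1 - m⁻¹ * b)) with hn_def
  have hdet : ((2 : ℝ) • (1 : Matrix (Fin 2) (Fin 2) ℝ) +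
      (m⁻¹ • !![ν * κ, 0; 0, ν * κ] + (1 - m⁻¹ * a + (1 - m⁻¹ * b)) • 1)).det = (2 + n) ^ 2 := by
    simp [det_fin_two, hn_def]
    ring
  rw [hdet, Real.sqrt_sq (by linarith), div_le_div_iff₀ (by linarith) (by linarith)]
  rw [le_div_iff₀ (by linarith)] at hn
  linarith
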